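/- arXiv:2602.21913 — 3 statements merged into one kernel-verified Lean document; each statement's English description precedes it below -/
import Mathlib

section
/- Let W be a linear subspace of V, u⁰ ∈ W, and p₁, …, p_M ∈ W pairwise a-orthogonal (a(p_k, p_ℓ) = 0 for k ≠ ℓ). Define uⁿ := u⁰ + Σ_{ℓ=1}^{n} p_ℓ for 0 ≤ n ≤ M, and suppose the final element u^M satisfies a(u^M, w) = ℓ(w) for all w ∈ W. Then for all integers n, d with 0 ≤ n and n + d ≤ M, the Hestenes–Stiefel quantity ξₙᵈ := Σ_{ℓ=n+1}^{n+d} ‖p_ℓ‖_a² satisfies ξₙᵈ = 2·(E(uⁿ) − E(u^{n+d})). -/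
/-- the Hestenes–Stiefel quantity
`ξₙᵈ = Σ_{l=n+1}^{n+d} ‖p_l‖_a²` equals `2·(E(uⁿ) − E(u^{n+d}))`. -/
theorem stmt_7
    {V : Type*} [NormedAddCommGroup V] [InnerProductSpace ℝ V] [CompleteSpace V]
    (a : V →L[ℝ] V →L[ℝ] ℝ)
    (hsymm : ∀ v w : V, a v w = a w v)
    (C : ℝ) (hC : 0 < C) (hcoer : ∀ v : V, C * ‖v‖ ^ 2 ≤ a v v)
    (ℓ : V →L[ℝ] ℝ)
    (E : V → ℝ) (hE : ∀ v : V, E v = (1 / 2) * a v v - ℓ v)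
    (W : Submodule ℝ V) (M : ℕ) (u0 : V) (hu0 : u0 ∈ W)
    (p : ℕ → V) (hp : ∀ i ∈ Finset.Icc 1 M, p i ∈ W)
    (horth : ∀ k ∈ Finset.Icc 1 M, ∀ l ∈ Finset.Icc 1 M, k ≠ l → a (p k) (p l) = 0)
    (u : ℕ → V) (hu : ∀ n : ℕ, u n = u0 + ∑ i ∈ Finset.Icc 1 n, p i)
    (hGal : ∀ w ∈ W, a (u M) w = ℓ w) :
    ∀ n d : ℕ, n + d ≤ M →
      ∑ i ∈ Finset.Icc (n + 1) (n + d), Real.sqrt (a (p i) (p i)) ^ 2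
        = 2 * (E (u n) - E (u (n + d))) := by
  have hnonneg : ∀ v : V, 0 ≤ a v v := fun v => le_trans (by positivity) (hcoer v)
  have hstep : ∀ m : ℕ, m + 1 ≤ M →
      a (p (m + 1)) (p (m + 1)) = 2 * (E (u m) - E (u (m + 1))) := by
    intro m hm
    have hmem : m + 1 ∈ Finset.Icc 1 M := Finset.mem_Icc.2 ⟨by omega, hm⟩
    have hsucc : u (m + 1) = u m + p (m + 1) := by
      rw [hu, hu, Finset.sum_Icc_succ_top (by omega), add_assoc]
    have hprev : a (u m) (p (m + 1)) = a u0 (p (m + 1)) := by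
      rw [hu, map_add, map_sum, add_apply, sum_apply,
        Finset.sum_eq_zero, add_zero]
      intro i hi
      rw [Finset.mem_Icc] at hi
      exact horth i (Finset.mem_Icc.2 ⟨hi.1, by omega⟩) _ hmem (by omega)
    have hlast : a (u M) (p (m + 1)) = a u0 (p (m + 1)) + a (p (m + 1)) (p (m + 1)) := by
      rw [hu, map_add, map_sum, add_apply, sum_apply,
        Finset.sum_eq_single_of_mem _ hmem]
      exact fun i hi hne => horth i hi _ hmem hne
    have hres := hGal _ (hp _ hmem)
    have hcomm := hsymm (p (m + 1)) (u m)
    rw [hE, hE, hsucc]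
    simp only [map_add, add_apply]
    linarith
  intro n d
  induction d with
  | zero => intro _; simp
  | succ d ih =>
    intro hd
    rw [← add_assoc] at hd ⊢
    rw [Finset.sum_Icc_succ_top (by omega), ih (by omega), Real.sq_sqrt (hnonneg _), hstep _ hd]
    ring
end

section
/- Let W be a linear subspace of V, u⁰ ∈ W, and p₁, …, p_M ∈ W pairwise a-orthogonal (a(p_k, p_ℓ) = 0 for k ≠ ℓ). Define uⁿ := u⁰ + Σ_{ℓ=1}^{n} p_ℓ for 0 ≤ n ≤ M, and suppose u^M satisfies a(u^M, w) = ℓ(w) for all w ∈ W. Then for each 0 ≤ n ≤ M, the iterate uⁿ minimizes E over the affine set {u⁰ + v : v ∈ span{p₁, …, pₙ}}, i.e. E(uⁿ) ≤ E(u⁰ + v) for every v in the span of p₁, …, pₙ. -/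
/-- A point where the linear-quadratic energy of a symmetric positive semidefinite form is
stationary in the direction `d` has energy at most that of its translate by `d`. -/
theorem quadratic_energy_le_add_of_stationary
    {V : Type*} [NormedAddCommGroup V] [NormedSpace ℝ V]
    (a : V →L[ℝ] V →L[ℝ] ℝ) (hsymm : ∀ v w : V, a v w = a w v)
    (hnonneg : ∀ v : V, 0 ≤ a v v) (ℓ : V →L[ℝ] ℝ) {x d : V} (hd : a x d = ℓ d) :
    (1 / 2) * a x x - ℓ x ≤ (1 / 2) * a (x + d) (x + d) - ℓ (x + d) := by
  simp only [map_add, add_apply]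
  linarith [hnonneg d, hsymm d x]

/-- Pairing with one member of an `a`-orthogonal family isolates its term in a sum. -/
theorem apply_add_sum_of_orthogonal
    {ι V : Type*} [NormedAddCommGroup V] [NormedSpace ℝ V]
    (a : V →L[ℝ] V →L[ℝ] ℝ) (x : V) (p : ι → V) (s : Finset ι)
    {k : ι} (hk : k ∈ s) (horth : ∀ i ∈ s, i ≠ k → a (p i) (p k) = 0) :
    a (x + ∑ i ∈ s, p i) (p k) = a x (p k) + a (p k) (p k) := by
  rw [map_add, map_sum, add_apply, sum_apply,
    Finset.sum_eq_single_of_mem k hk horth]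

/-- the iterate `uⁿ` minimizes `E` over the affine set
`{u⁰ + v : v ∈ span{p₁, …, pₙ}}`. -/
theorem stmt_9
    {V : Type*} [NormedAddCommGroup V] [InnerProductSpace ℝ V] [CompleteSpace V]
    (a : V →L[ℝ] V →L[ℝ] ℝ)
    (hsymm : ∀ v w : V, a v w = a w v)
    (C : ℝ) (hC : 0 < C) (hcoer : ∀ v : V, C * ‖v‖ ^ 2 ≤ a v v)
    (ℓ : V →L[ℝ] ℝ)
    (E : V → ℝ) (hE : ∀ v : V, E v = (1 / 2) * a v v - ℓ v)
    (W : Submodule ℝ V) (M : ℕ) (u0 : V) (hu0 : u0 ∈ W)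
    (p : ℕ → V) (hp : ∀ i ∈ Finset.Icc 1 M, p i ∈ W)
    (horth : ∀ k ∈ Finset.Icc 1 M, ∀ l ∈ Finset.Icc 1 M, k ≠ l → a (p k) (p l) = 0)
    (u : ℕ → V) (hu : ∀ n : ℕ, u n = u0 + ∑ i ∈ Finset.Icc 1 n, p i)
    (hGal : ∀ w ∈ W, a (u M) w = ℓ w) :
    ∀ n : ℕ, n ≤ M →
      ∀ v ∈ Submodule.span ℝ (p '' {i : ℕ | 1 ≤ i ∧ i ≤ n}),
        E (u n) ≤ E (u0 + v) := by
  intro n hn v hv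
  have hsub : Finset.Icc 1 n ⊆ Finset.Icc 1 M := Finset.Icc_subset_Icc_right hn
  have hspan : Submodule.span ℝ (p '' {i : ℕ | 1 ≤ i ∧ i ≤ n}) ≤
      LinearMap.ker (a (u n) - ℓ).toLinearMap := by
    rw [Submodule.span_le]
    rintro _ ⟨k, hk, rfl⟩
    have hkn : k ∈ Finset.Icc 1 n := Finset.mem_Icc.2 hk
    have hkM := hsub hkn
    have hpair : a (u n) (p k) = a (u M) (p k) := by
      rw [hu, hu,
        apply_add_sum_of_orthogonal a u0 p _ hkn fun i hi => horth i (hsub hi) k hkM,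
        apply_add_sum_of_orthogonal a u0 p _ hkM fun i hi => horth i hi k hkM]
    simp [hpair, hGal _ (hp k hkM)]
  have hsum : ∑ i ∈ Finset.Icc 1 n, p i ∈ Submodule.span ℝ (p '' {i : ℕ | 1 ≤ i ∧ i ≤ n}) :=
    Submodule.sum_mem _ fun i hi =>
      Submodule.subset_span ⟨i, Finset.mem_Icc.1 hi, rfl⟩
  have hd : a (u n) (v - ∑ i ∈ Finset.Icc 1 n, p i) = ℓ (v - ∑ i ∈ Finset.Icc 1 n, p i) :=
    sub_eq_zero.1 (hspan (Submodule.sub_mem _ hv hsum))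
  have hmove : u0 + v = u n + (v - ∑ i ∈ Finset.Icc 1 n, p i) := by
    rw [hu]; abel
  rw [hE, hE, hmove]
  exact quadratic_energy_le_add_of_stationary a hsymm
    (fun w => (by positivity : 0 ≤ C * ‖w‖ ^ 2).trans (hcoer w)) ℓ hd
end

section
/- Let u⋆, φ ∈ V and let α, β ∈ ℝ solve the 2×2 local system a(α·u⋆ + β·φ, u⋆) = ℓ(u⋆) and a(α·u⋆ + β·φ, φ) = ℓ(φ). Then the energy decay admits the closed form E(u⋆) − E(α·u⋆ + β·φ) = ((1−α)²/2)·a(u⋆, u⋆) − β·(1−α)·a(u⋆, φ) + (β²/2)·a(φ, φ). -/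
/-- closed form of the local energy decay for the `2×2` local
Galerkin system spanned by `u⋆` and `φ`. -/
theorem stmt_13
    {V : Type*} [NormedAddCommGroup V] [InnerProductSpace ℝ V] [CompleteSpace V]
    (a : V →L[ℝ] V →L[ℝ] ℝ)
    (hsymm : ∀ v w : V, a v w = a w v)
    (C : ℝ) (hC : 0 < C) (hcoer : ∀ v : V, C * ‖v‖ ^ 2 ≤ a v v)
    (ℓ : V →L[ℝ] ℝ)
    (E : V → ℝ) (hE : ∀ v : V, E v = (1 / 2) * a v v - ℓ v)
    (ustar φ : V) (α β : ℝ)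
    (h1 : a (α • ustar + β • φ) ustar = ℓ ustar)
    (h2 : a (α • ustar + β • φ) φ = ℓ φ) :
    E ustar - E (α • ustar + β • φ)
      = (1 - α) ^ 2 / 2 * a ustar ustar
        - β * (1 - α) * a ustar φ
        + β ^ 2 / 2 * a φ φ := by
  simp only [map_add, map_smul, add_apply,
    smul_apply, smul_eq_mul, hsymm φ ustar, hE] at h1 h2 ⊢
  linear_combination (1 - α) * h1 - β * h2
end
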